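/- Let (A, α_A) be a finite-dimensional Hom-bialgebra and (H, α_H) a Hom-bialgebra over a field k, and let Φ : H⊗A → A⊗H be a Hom-monoidal entwining datum. Let φ(f⊗h) = Σ_i f((e_i)_Φ) h^Φ ⊗ e^i be the associated Hom-cotwistor (for dual bases (e_i) of A and (e^i) of A*). Then A*⊗H, equipped with the structure map ᾱ⊗α_H, comultiplication Δ̂(f⊗h) = Σ (f_[1] ⊗ (h₁)^φ) ⊗ ((f_[2])^φ ⊗ h₂) (φ applied to f_[2]⊗h₁, with f_[1]⊗f_[2] the A*^cop-comultiplication), counit ε̂(f⊗h) = f(1_A)ε_H(h), product (f⊗x)(f'⊗y) = f∗f' ⊗ xy where (f∗f')(z) = f(α_A^{-2}(z₁)) f'(α_A^{-2}(z₂)), and unit ε_A⊗1_H, is a Hom-bialgebra over k. -/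

import Mathlib

open TensorProduct BigOperators

noncomputable section

variable (k : Type*) [Field k]

section HomDefs

variable {A B C H U X Y Z : Type*}
variable [AddCommGroup A] [Module k A] [AddCommGroup B] [Module k B]
variable [AddCommGroup C] [Module k C] [AddCommGroup H] [Module k H]
variable [AddCommGroup U] [Module k U] [AddCommGroup X] [Module k X]
variable [AddCommGroup Y] [Module k Y] [AddCommGroup Z] [Module k Z]

/-- A Hom-algebra `(A, α, μ, e)` over `k`. -/
def IsHomAlgebra (α : A ≃ₗ[k] A) (μ : A →ₗ[k] A →ₗ[k] A) (e : A) : Prop :=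
  (∀ a b, α (μ a b) = μ (α a) (α b)) ∧
  (∀ a b c, μ (α a) (μ b c) = μ (μ a b) (α c)) ∧
  α e = e ∧ (∀ a, μ e a = α a) ∧ (∀ a, μ a e = α a)

/-- A Hom-coalgebra `(C, α, Δ, ε)` over `k`. -/
def IsHomCoalgebra (α : C ≃ₗ[k] C) (Δ : C →ₗ[k] C ⊗[k] C) (ε : C →ₗ[k] k) : Prop :=
  (∀ c, Δ (α c) = TensorProduct.map α.toLinearMap α.toLinearMap (Δ c)) ∧
  (∀ c, ε (α c) = ε c) ∧
  (∀ c, TensorProduct.map α.toLinearMap Δ (Δ c)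
      = TensorProduct.assoc k C C C (TensorProduct.map Δ α.toLinearMap (Δ c))) ∧
  (∀ c, TensorProduct.lid k C (TensorProduct.map ε (LinearMap.id : C →ₗ[k] C) (Δ c)) = α c) ∧
  (∀ c, TensorProduct.rid k C (TensorProduct.map (LinearMap.id : C →ₗ[k] C) ε (Δ c)) = α c)

/-- A Hom-bialgebra `(H, α, μ, e, Δ, ε)` over `k`. -/
def IsHomBialgebra (α : H ≃ₗ[k] H) (μ : H →ₗ[k] H →ₗ[k] H) (e : H)
    (Δ : H →ₗ[k] H ⊗[k] H) (ε : H →ₗ[k] k) : Prop :=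
  IsHomAlgebra k α μ e ∧ IsHomCoalgebra k α Δ ε ∧
  (∀ a b, Δ (μ a b) = TensorProduct.map (TensorProduct.lift μ) (TensorProduct.lift μ)
      (TensorProduct.tensorTensorTensorComm k H H H H (Δ a ⊗ₜ[k] Δ b))) ∧
  Δ e = e ⊗ₜ[k] e ∧
  (∀ a b, ε (μ a b) = ε a * ε b) ∧
  ε e = 1

/-- A right `A`-Hom-module `(U, αU, act)`. -/
def IsHomModule (αA : A ≃ₗ[k] A) (μ : A →ₗ[k] A →ₗ[k] A) (e : A)
    (αU : U ≃ₗ[k] U) (act : U →ₗ[k] A →ₗ[k] U) : Prop :=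
  (∀ u a, αU (act u a) = act (αU u) (αA a)) ∧
  (∀ u, act u e = αU u) ∧
  (∀ u a b, act (act u a) (αA b) = act (αU u) (μ a b))

/-- A right `H`-Hom-comodule `(U, αU, ρ)`. -/
def IsHomComodule (αH : H ≃ₗ[k] H) (Δ : H →ₗ[k] H ⊗[k] H) (ε : H →ₗ[k] k)
    (αU : U ≃ₗ[k] U) (ρ : U →ₗ[k] U ⊗[k] H) : Prop :=
  (∀ u, ρ (αU u) = TensorProduct.map αU.toLinearMap αH.toLinearMap (ρ u)) ∧
  (∀ u, TensorProduct.map αU.toLinearMap Δ (ρ u)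
      = TensorProduct.assoc k U H H (TensorProduct.map ρ αH.toLinearMap (ρ u))) ∧
  (∀ u, TensorProduct.rid k U (TensorProduct.map (LinearMap.id : U →ₗ[k] U) ε (ρ u)) = αU u)

/-- A Hom-cotwistor `φ : B ⊗ H → H ⊗ B` between Hom-coalgebras `B` and `H`
(conditions (M1)-(M4) together with compatibility with the structure maps). -/
def IsHomCotwistor (αB : B ≃ₗ[k] B) (ΔB : B →ₗ[k] B ⊗[k] B) (εB : B →ₗ[k] k)
    (αH : H ≃ₗ[k] H) (ΔH : H →ₗ[k] H ⊗[k] H) (εH : H →ₗ[k] k)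
    (φ : B ⊗[k] H →ₗ[k] H ⊗[k] B) : Prop :=
  (φ ∘ₗ TensorProduct.map αB.toLinearMap αH.toLinearMap
     = TensorProduct.map αH.toLinearMap αB.toLinearMap ∘ₗ φ) ∧
  -- (M1)
  (TensorProduct.map αH.toLinearMap ΔB ∘ₗ φ
     = (TensorProduct.assoc k H B B).toLinearMap
       ∘ₗ TensorProduct.map φ (LinearMap.id : B →ₗ[k] B)
       ∘ₗ (TensorProduct.assoc k B H B).symm.toLinearMap
       ∘ₗ TensorProduct.map (LinearMap.id : B →ₗ[k] B) φ
       ∘ₗ (TensorProduct.assoc k B B H).toLinearMap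
       ∘ₗ TensorProduct.map ΔB αH.toLinearMap) ∧
  -- (M2)
  (TensorProduct.map ΔH αB.toLinearMap ∘ₗ φ
     = (TensorProduct.assoc k H H B).symm.toLinearMap
       ∘ₗ TensorProduct.map (LinearMap.id : H →ₗ[k] H) φ
       ∘ₗ (TensorProduct.assoc k H B H).toLinearMap
       ∘ₗ TensorProduct.map φ (LinearMap.id : H →ₗ[k] H)
       ∘ₗ (TensorProduct.assoc k B H H).symm.toLinearMap
       ∘ₗ TensorProduct.map αB.toLinearMap ΔH) ∧
  -- (M3)
  ((TensorProduct.lid k B).toLinearMap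
      ∘ₗ TensorProduct.map εH (LinearMap.id : B →ₗ[k] B) ∘ₗ φ
     = (TensorProduct.rid k B).toLinearMap
        ∘ₗ TensorProduct.map (LinearMap.id : B →ₗ[k] B) εH) ∧
  -- (M4)
  ((TensorProduct.rid k H).toLinearMap
      ∘ₗ TensorProduct.map (LinearMap.id : H →ₗ[k] H) εB ∘ₗ φ
     = (TensorProduct.lid k H).toLinearMap
        ∘ₗ TensorProduct.map εB (LinearMap.id : H →ₗ[k] H))

/-- A monoidal Hom-cotwistor between Hom-bialgebras `B` and `H`:
a Hom-cotwistor additionally satisfying (M5) and (M6). -/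
def IsMonoidalHomCotwistor (αB : B ≃ₗ[k] B) (μB : B →ₗ[k] B →ₗ[k] B) (eB : B)
    (ΔB : B →ₗ[k] B ⊗[k] B) (εB : B →ₗ[k] k)
    (αH : H ≃ₗ[k] H) (μH : H →ₗ[k] H →ₗ[k] H) (eH : H)
    (ΔH : H →ₗ[k] H ⊗[k] H) (εH : H →ₗ[k] k)
    (φ : B ⊗[k] H →ₗ[k] H ⊗[k] B) : Prop :=
  IsHomCotwistor k αB ΔB εB αH ΔH εH φ ∧
  -- (M5)
  (TensorProduct.map (TensorProduct.lift μH) (TensorProduct.lift μB)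
      ∘ₗ (TensorProduct.tensorTensorTensorComm k H B H B).toLinearMap
      ∘ₗ TensorProduct.map φ φ
    = φ ∘ₗ TensorProduct.map (TensorProduct.lift μB) (TensorProduct.lift μH)
        ∘ₗ (TensorProduct.tensorTensorTensorComm k B H B H).toLinearMap) ∧
  -- (M6)
  φ (eB ⊗ₜ[k] eH) = eH ⊗ₜ[k] eB

/-- A Hom-entwining map `Φ : H ⊗ A → A ⊗ H` (conditions (E1)-(E4) together
with compatibility with the structure maps); `(H, A, Φ)` is then a
Hom-entwining structure. -/
def IsHomEntwining (αA : A ≃ₗ[k] A) (μ : A →ₗ[k] A →ₗ[k] A) (e : A)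
    (αH : H ≃ₗ[k] H) (Δ : H →ₗ[k] H ⊗[k] H) (ε : H →ₗ[k] k)
    (Φ : H ⊗[k] A →ₗ[k] A ⊗[k] H) : Prop :=
  (TensorProduct.map αA.toLinearMap αH.toLinearMap ∘ₗ Φ
     = Φ ∘ₗ TensorProduct.map αH.toLinearMap αA.toLinearMap) ∧
  -- (E1)
  (TensorProduct.map (TensorProduct.lift μ) αH.toLinearMap
      ∘ₗ (TensorProduct.assoc k A A H).symm.toLinearMap
      ∘ₗ TensorProduct.map (LinearMap.id : A →ₗ[k] A) Φ
      ∘ₗ (TensorProduct.assoc k A H A).toLinearMap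
      ∘ₗ TensorProduct.map Φ (LinearMap.id : A →ₗ[k] A)
    = Φ ∘ₗ TensorProduct.map αH.toLinearMap (TensorProduct.lift μ)
        ∘ₗ (TensorProduct.assoc k H A A).toLinearMap) ∧
  -- (E2)
  (TensorProduct.map αA.toLinearMap Δ ∘ₗ Φ
     = (TensorProduct.assoc k A H H).toLinearMap
       ∘ₗ TensorProduct.map Φ (LinearMap.id : H →ₗ[k] H)
       ∘ₗ (TensorProduct.assoc k H A H).symm.toLinearMap
       ∘ₗ TensorProduct.map (LinearMap.id : H →ₗ[k] H) Φ
       ∘ₗ (TensorProduct.assoc k H H A).toLinearMap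
       ∘ₗ TensorProduct.map Δ αA.toLinearMap) ∧
  -- (E3)
  ((TensorProduct.rid k A).toLinearMap
      ∘ₗ TensorProduct.map (LinearMap.id : A →ₗ[k] A) ε ∘ₗ Φ
     = (TensorProduct.lid k A).toLinearMap
        ∘ₗ TensorProduct.map ε (LinearMap.id : A →ₗ[k] A)) ∧
  -- (E4)
  (∀ h, Φ (h ⊗ₜ[k] e) = e ⊗ₜ[k] h)

/-- A Hom-monoidal entwining datum between Hom-bialgebras `H` (coalgebra side)
and `A` (algebra side): a Hom-entwining map additionally satisfying (E5), (E6). -/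
def IsHomMonoidalEntwining (αA : A ≃ₗ[k] A) (μA : A →ₗ[k] A →ₗ[k] A) (eA : A)
    (ΔA : A →ₗ[k] A ⊗[k] A) (εA : A →ₗ[k] k)
    (αH : H ≃ₗ[k] H) (μH : H →ₗ[k] H →ₗ[k] H) (eH : H)
    (ΔH : H →ₗ[k] H ⊗[k] H) (εH : H →ₗ[k] k)
    (Φ : H ⊗[k] A →ₗ[k] A ⊗[k] H) : Prop :=
  IsHomEntwining k αA μA eA αH ΔH εH Φ ∧
  -- (E5)
  (TensorProduct.map (LinearMap.id : A ⊗[k] A →ₗ[k] A ⊗[k] A) (TensorProduct.lift μH)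
      ∘ₗ (TensorProduct.tensorTensorTensorComm k A H A H).toLinearMap
      ∘ₗ TensorProduct.map Φ Φ
      ∘ₗ (TensorProduct.tensorTensorTensorComm k H H A A).toLinearMap
      ∘ₗ TensorProduct.map
           (TensorProduct.map (αH.toLinearMap ∘ₗ αH.toLinearMap)
             (αH.toLinearMap ∘ₗ αH.toLinearMap)) ΔA
    = TensorProduct.map ΔA (αH.toLinearMap ∘ₗ αH.toLinearMap)
        ∘ₗ Φ ∘ₗ TensorProduct.map (TensorProduct.lift μH) (LinearMap.id : A →ₗ[k] A)) ∧
  -- (E6)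
  (∀ a, TensorProduct.lid k H
      (TensorProduct.map εA (LinearMap.id : H →ₗ[k] H) (Φ (eH ⊗ₜ[k] a))) = εA a • eH)

/-- An `n`-th Hom-entwined module over a Hom-entwining structure `(H, A, Φ)`. -/
def IsHomEntwinedModule (αA : A ≃ₗ[k] A) (μ : A →ₗ[k] A →ₗ[k] A) (e : A)
    (αH : H ≃ₗ[k] H) (Δ : H →ₗ[k] H ⊗[k] H) (ε : H →ₗ[k] k)
    (Φ : H ⊗[k] A →ₗ[k] A ⊗[k] H) (n : ℤ)
    (αU : U ≃ₗ[k] U) (act : U →ₗ[k] A →ₗ[k] U) (ρ : U →ₗ[k] U ⊗[k] H) : Prop :=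
  IsHomModule k αA μ e αU act ∧
  IsHomComodule k αH Δ ε αU ρ ∧
  ∀ u a, ρ (act u a)
    = TensorProduct.map
        (TensorProduct.lift act ∘ₗ
          TensorProduct.map (LinearMap.id : U →ₗ[k] U) αA.toLinearMap)
        ((αH ^ (-n)).toLinearMap)
        ((TensorProduct.assoc k U A H).symm
          (TensorProduct.map (LinearMap.id : U →ₗ[k] U)
            (Φ ∘ₗ TensorProduct.map ((αH ^ (n + 1)).toLinearMap)
               (LinearMap.id : A →ₗ[k] A))
            (TensorProduct.assoc k U H A (ρ u ⊗ₜ[k] a))))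

/-- A Hom-Long dimodule over a Hom-bialgebra `H`. -/
def IsHomLongDimodule (αH : H ≃ₗ[k] H) (μ : H →ₗ[k] H →ₗ[k] H) (e : H)
    (Δ : H →ₗ[k] H ⊗[k] H) (ε : H →ₗ[k] k)
    (αU : U ≃ₗ[k] U) (act : U →ₗ[k] H →ₗ[k] U) (ρ : U →ₗ[k] U ⊗[k] H) : Prop :=
  IsHomModule k αH μ e αU act ∧
  IsHomComodule k αH Δ ε αU ρ ∧
  ∀ u h, ρ (act u h)
    = TensorProduct.map (TensorProduct.lift act) αH.toLinearMap
        ((TensorProduct.assoc k U H H).symm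
          (TensorProduct.map (LinearMap.id : U →ₗ[k] U)
            (TensorProduct.comm k H H).toLinearMap
            (TensorProduct.assoc k U H H (ρ u ⊗ₜ[k] αH h))))

/-- A right `H`-comodule algebra over a Hom-bialgebra `H`. -/
def IsHomComoduleAlgebra (αH : H ≃ₗ[k] H) (μH : H →ₗ[k] H →ₗ[k] H) (eH : H)
    (ΔH : H →ₗ[k] H ⊗[k] H) (εH : H →ₗ[k] k)
    (αA : A ≃ₗ[k] A) (μA : A →ₗ[k] A →ₗ[k] A) (eA : A)
    (ρA : A →ₗ[k] A ⊗[k] H) : Prop :=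
  IsHomAlgebra k αA μA eA ∧
  IsHomComodule k αH ΔH εH αA ρA ∧
  (∀ a b, ρA (μA a b) = TensorProduct.map (TensorProduct.lift μA) (TensorProduct.lift μH)
      (TensorProduct.tensorTensorTensorComm k A H A H (ρA a ⊗ₜ[k] ρA b))) ∧
  ρA eA = eA ⊗ₜ[k] eH

/-- A right `H`-module coalgebra over a Hom-bialgebra `H`. -/
def IsHomModuleCoalgebra (αH : H ≃ₗ[k] H) (μH : H →ₗ[k] H →ₗ[k] H) (eH : H)
    (ΔH : H →ₗ[k] H ⊗[k] H) (εH : H →ₗ[k] k)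
    (αC : C ≃ₗ[k] C) (ΔC : C →ₗ[k] C ⊗[k] C) (εC : C →ₗ[k] k)
    (act : C →ₗ[k] H →ₗ[k] C) : Prop :=
  IsHomCoalgebra k αC ΔC εC ∧
  IsHomModule k αH μH eH αC act ∧
  (∀ c h, ΔC (act c h) = TensorProduct.map (TensorProduct.lift act) (TensorProduct.lift act)
      (TensorProduct.tensorTensorTensorComm k C C H H (ΔC c ⊗ₜ[k] ΔH h))) ∧
  (∀ c h, εC (act c h) = εC c * εH h)

/-- A Hom-Hopf algebra `(H, α, μ, e, Δ, ε, S)` over `k`. -/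
def IsHomHopf (αH : H ≃ₗ[k] H) (μ : H →ₗ[k] H →ₗ[k] H) (e : H)
    (Δ : H →ₗ[k] H ⊗[k] H) (ε : H →ₗ[k] k) (S : H →ₗ[k] H) : Prop :=
  IsHomBialgebra k αH μ e Δ ε ∧
  (∀ h, S (αH h) = αH (S h)) ∧
  (∀ h, TensorProduct.lift μ
      (TensorProduct.map S (LinearMap.id : H →ₗ[k] H) (Δ h)) = ε h • e) ∧
  (∀ h, TensorProduct.lift μ
      (TensorProduct.map (LinearMap.id : H →ₗ[k] H) S (Δ h)) = ε h • e)

/-- A `p`-th right-right Yetter-Drinfeld module over a Hom-Hopf algebra `H`. -/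
def IsYetterDrinfeld (αH : H ≃ₗ[k] H) (μ : H →ₗ[k] H →ₗ[k] H) (e : H)
    (Δ : H →ₗ[k] H ⊗[k] H) (ε : H →ₗ[k] k) (S : H →ₗ[k] H) (p : ℤ)
    (αU : U ≃ₗ[k] U) (act : U →ₗ[k] H →ₗ[k] U) (ρ : U →ₗ[k] U ⊗[k] H) : Prop :=
  IsHomModule k αH μ e αU act ∧
  IsHomComodule k αH Δ ε αU ρ ∧
  ∀ u h, ρ (act u h)
    = TensorProduct.map
        (TensorProduct.lift act ∘ₗ
          TensorProduct.map (LinearMap.id : U →ₗ[k] U) αH.symm.toLinearMap)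
        (TensorProduct.lift μ ∘ₗ
          TensorProduct.map (S ∘ₗ (αH ^ (p - 2)).toLinearMap)
            (TensorProduct.lift μ ∘ₗ
              TensorProduct.map αH.symm.toLinearMap ((αH ^ (p - 4)).toLinearMap)))
        (TensorProduct.tensorTensorTensorComm k U H H (H ⊗[k] H)
          (TensorProduct.map (LinearMap.id : U ⊗[k] H →ₗ[k] U ⊗[k] H)
            (TensorProduct.leftComm k H H H).toLinearMap
            (TensorProduct.tensorTensorTensorComm k U H H (H ⊗[k] H)
              (ρ u ⊗ₜ[k]
                TensorProduct.map (LinearMap.id : H →ₗ[k] H) Δ (Δ h)))))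

/-- The smash coproduct comultiplication on `B ⊗ H` induced by
`φ : B ⊗ H → H ⊗ B`: `Δ(b ⊗ h) = (b₁ ⊗ (h₁)^φ) ⊗ ((b₂)^φ ⊗ h₂)`. -/
def smashComul (φ : B ⊗[k] H →ₗ[k] H ⊗[k] B) (ΔB : B →ₗ[k] B ⊗[k] B)
    (ΔH : H →ₗ[k] H ⊗[k] H) : B ⊗[k] H →ₗ[k] (B ⊗[k] H) ⊗[k] (B ⊗[k] H) :=
  (TensorProduct.assoc k B H (B ⊗[k] H)).symm.toLinearMap
  ∘ₗ TensorProduct.map (LinearMap.id : B →ₗ[k] B)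
       (TensorProduct.assoc k H B H).toLinearMap
  ∘ₗ TensorProduct.map (LinearMap.id : B →ₗ[k] B)
       (TensorProduct.map φ (LinearMap.id : H →ₗ[k] H))
  ∘ₗ TensorProduct.map (LinearMap.id : B →ₗ[k] B)
       (TensorProduct.assoc k B H H).symm.toLinearMap
  ∘ₗ (TensorProduct.assoc k B B (H ⊗[k] H)).toLinearMap
  ∘ₗ TensorProduct.map ΔB ΔH

/-- The smash coproduct counit on `B ⊗ H`: `ε(b ⊗ h) = εB(b) εH(h)`. -/
def smashCounit (εB : B →ₗ[k] k) (εH : H →ₗ[k] k) : B ⊗[k] H →ₗ[k] k :=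
  (TensorProduct.lid k k).toLinearMap ∘ₗ TensorProduct.map εB εH

/-- The componentwise product on `B ⊗ H`: `(a ⊗ h)(b ⊗ g) = ab ⊗ hg`. -/
def smashMul (μB : B →ₗ[k] B →ₗ[k] B) (μH : H →ₗ[k] H →ₗ[k] H) :
    B ⊗[k] H →ₗ[k] B ⊗[k] H →ₗ[k] B ⊗[k] H :=
  (TensorProduct.mk k (B ⊗[k] H) (B ⊗[k] H)).compr₂
    (TensorProduct.map (TensorProduct.lift μB) (TensorProduct.lift μH)
      ∘ₗ (TensorProduct.tensorTensorTensorComm k B H B H).toLinearMap)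

/-- Threefold "componentwise comultiplication" `(C⊗C)⊗C → ((C⊗C)⊗C) ⊗ ((C⊗C)⊗C)`
obtained by applying `Δ2` to each factor and pairing the first and second legs. -/
def convDelta3 (Δ2 : C →ₗ[k] C ⊗[k] C) :
    (C ⊗[k] C) ⊗[k] C →ₗ[k] ((C ⊗[k] C) ⊗[k] C) ⊗[k] ((C ⊗[k] C) ⊗[k] C) :=
  (TensorProduct.tensorTensorTensorComm k (C ⊗[k] C) (C ⊗[k] C) C C).toLinearMap
  ∘ₗ TensorProduct.map (TensorProduct.tensorTensorTensorComm k C C C C).toLinearMap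
       (LinearMap.id : C ⊗[k] C →ₗ[k] C ⊗[k] C)
  ∘ₗ TensorProduct.map (TensorProduct.map Δ2 Δ2) Δ2

/-- The map `ξ_{X,Y}(x ⊗ y) = α_X⁻¹(x)·α_H^m(y₍₁₎) ⊗ α_Y⁻¹(y₍₀₎)` for
Hom-Long dimodules `X`, `Y`. -/
def longXi (m : ℤ) (αH : H ≃ₗ[k] H) (αX : X ≃ₗ[k] X) (αY : Y ≃ₗ[k] Y)
    (act : X →ₗ[k] H →ₗ[k] X) (ρ : Y →ₗ[k] Y ⊗[k] H) : X ⊗[k] Y →ₗ[k] X ⊗[k] Y :=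
  TensorProduct.map
      (TensorProduct.lift act ∘ₗ
        TensorProduct.map (LinearMap.id : X →ₗ[k] X) ((αH ^ m).toLinearMap))
      αY.symm.toLinearMap
    ∘ₗ (TensorProduct.assoc k X H Y).symm.toLinearMap
    ∘ₗ TensorProduct.map (LinearMap.id : X →ₗ[k] X) (TensorProduct.comm k Y H).toLinearMap
    ∘ₗ TensorProduct.map αX.symm.toLinearMap ρ

/-- The associativity constraint `a_{X,Y,Z}((x⊗y)⊗z) = α_X^{i+1}(x) ⊗ (y ⊗ α_Z^{-j-1}(z))`. -/
def homAssoc (i j : ℤ) (αX : X ≃ₗ[k] X) (αZ : Z ≃ₗ[k] Z) :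
    (X ⊗[k] Y) ⊗[k] Z ≃ₗ[k] X ⊗[k] (Y ⊗[k] Z) :=
  (TensorProduct.assoc k X Y Z).trans
    (TensorProduct.congr (αX ^ (i + 1))
      (TensorProduct.congr (LinearEquiv.refl k Y) (αZ ^ (-j - 1))))

/-- The braiding `τ_{X,Y}(x ⊗ y) = α_Y^{j-i-1}(y₍₀₎) ⊗ α_X^{i-j-1}(x)·α_H^{-p}(y₍₁₎)`
for Yetter-Drinfeld modules. -/
def ydTau (p i j : ℤ) (αH : H ≃ₗ[k] H) (αX : X ≃ₗ[k] X) (αY : Y ≃ₗ[k] Y)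
    (act : X →ₗ[k] H →ₗ[k] X) (ρ : Y →ₗ[k] Y ⊗[k] H) : X ⊗[k] Y →ₗ[k] Y ⊗[k] X :=
  TensorProduct.map ((αY ^ (j - i - 1)).toLinearMap)
      (TensorProduct.lift act ∘ₗ
        TensorProduct.map ((αX ^ (i - j - 1)).toLinearMap) ((αH ^ (-p)).toLinearMap))
    ∘ₗ (TensorProduct.leftComm k X Y H).toLinearMap
    ∘ₗ TensorProduct.map (LinearMap.id : X →ₗ[k] X) ρ

end HomDefs

section SmashCoproduct

variable {k}
variable {B H : Type*} [AddCommGroup B] [Module k B] [AddCommGroup H] [Module k H]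

/-- The shuffle `(x ⊗ y) ⊗ (u ⊗ v) ↦ (x ⊗ u^φ) ⊗ (y^φ ⊗ v)` underlying `smashComul`. -/
def smashShuffle (φ : B ⊗[k] H →ₗ[k] H ⊗[k] B) :
    (B ⊗[k] B) ⊗[k] (H ⊗[k] H) →ₗ[k] (B ⊗[k] H) ⊗[k] (B ⊗[k] H) :=
  (TensorProduct.assoc k B H (B ⊗[k] H)).symm.toLinearMap
  ∘ₗ TensorProduct.map (LinearMap.id : B →ₗ[k] B)
       (TensorProduct.assoc k H B H).toLinearMap
  ∘ₗ TensorProduct.map (LinearMap.id : B →ₗ[k] B)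
       (TensorProduct.map φ (LinearMap.id : H →ₗ[k] H))
  ∘ₗ TensorProduct.map (LinearMap.id : B →ₗ[k] B)
       (TensorProduct.assoc k B H H).symm.toLinearMap
  ∘ₗ (TensorProduct.assoc k B B (H ⊗[k] H)).toLinearMap

theorem smashComul_tmul (φ : B ⊗[k] H →ₗ[k] H ⊗[k] B) (ΔB : B →ₗ[k] B ⊗[k] B)
    (ΔH : H →ₗ[k] H ⊗[k] H) (b : B) (h : H) :
    smashComul k φ ΔB ΔH (b ⊗ₜ h) = smashShuffle φ (ΔB b ⊗ₜ ΔH h) := rfl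

theorem smashShuffle_tmul (φ : B ⊗[k] H →ₗ[k] H ⊗[k] B) (x y : B) (u v : H) :
    smashShuffle φ ((x ⊗ₜ y) ⊗ₜ (u ⊗ₜ v)) = (TensorProduct.assoc k B H (B ⊗[k] H)).symm
      (x ⊗ₜ TensorProduct.assoc k H B H (φ (y ⊗ₜ u) ⊗ₜ v)) := rfl

theorem smashMul_tmul (μB : B →ₗ[k] B →ₗ[k] B) (μH : H →ₗ[k] H →ₗ[k] H) (a b : B) (g h : H) :
    smashMul k μB μH (a ⊗ₜ g) (b ⊗ₜ h) = μB a b ⊗ₜ μH g h := rfl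

theorem smashCounit_tmul (εB : B →ₗ[k] k) (εH : H →ₗ[k] k) (b : B) (h : H) :
    smashCounit k εB εH (b ⊗ₜ h) = εB b * εH h := rfl

theorem isHomAlgebra_smashMul {αB : B ≃ₗ[k] B} {μB : B →ₗ[k] B →ₗ[k] B} {eB : B}
    {αH : H ≃ₗ[k] H} {μH : H →ₗ[k] H →ₗ[k] H} {eH : H}
    (hB : IsHomAlgebra k αB μB eB) (hH : IsHomAlgebra k αH μH eH) :
    IsHomAlgebra k (TensorProduct.congr αB αH) (smashMul k μB μH) (eB ⊗ₜ[k] eH) := by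
  obtain ⟨hB1, hB2, hB3, hB4, hB5⟩ := hB
  obtain ⟨hH1, hH2, hH3, hH4, hH5⟩ := hH
  refine ⟨fun a b => ?_, fun a b c => ?_, ?_, fun a => ?_, fun a => ?_⟩
  · induction a with
    | zero => simp
    | add x y hx hy => simp only [map_add, LinearMap.add_apply, hx, hy]
    | tmul x u =>
      induction b with
      | zero => simp
      | add x y hx hy => simp only [map_add, hx, hy]
      | tmul y v => simp only [smashMul_tmul, congr_tmul, hB1, hH1]
  · induction a with
    | zero => simp
    | add x y hx hy => simp only [map_add, LinearMap.add_apply, hx, hy]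
    | tmul x u =>
      induction b with
      | zero => simp
      | add x y hx hy => simp only [map_add, LinearMap.add_apply, hx, hy]
      | tmul y v =>
        induction c with
        | zero => simp
        | add x y hx hy => simp only [map_add, hx, hy]
        | tmul z w => simp only [smashMul_tmul, congr_tmul, hB2, hH2]
  · simp only [congr_tmul, hB3, hH3]
  · induction a with
    | zero => simp
    | add x y hx hy => simp only [map_add, hx, hy]
    | tmul x u => simp only [smashMul_tmul, congr_tmul, hB4, hH4]
  · induction a with
    | zero => simp
    | add x y hx hy => simp only [map_add, LinearMap.add_apply, hx, hy]
    | tmul x u => simp only [smashMul_tmul, congr_tmul, hB5, hH5]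

/-- The map `y ⊗ z ⊗ u ↦ u^{φψ} ⊗ y^ψ ⊗ z^φ`. -/
def cotwistorLeft (φ : B ⊗[k] H →ₗ[k] H ⊗[k] B) :
    (B ⊗[k] B) ⊗[k] H →ₗ[k] H ⊗[k] (B ⊗[k] B) :=
  (TensorProduct.assoc k H B B).toLinearMap
    ∘ₗ TensorProduct.map φ (LinearMap.id : B →ₗ[k] B)
    ∘ₗ (TensorProduct.assoc k B H B).symm.toLinearMap
    ∘ₗ TensorProduct.map (LinearMap.id : B →ₗ[k] B) φ
    ∘ₗ (TensorProduct.assoc k B B H).toLinearMap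

/-- The map `z ⊗ (u ⊗ v) ↦ u^φ ⊗ v^χ ⊗ z^{φχ}`. -/
def cotwistorRight (φ : B ⊗[k] H →ₗ[k] H ⊗[k] B) :
    B ⊗[k] (H ⊗[k] H) →ₗ[k] (H ⊗[k] H) ⊗[k] B :=
  (TensorProduct.assoc k H H B).symm.toLinearMap
    ∘ₗ TensorProduct.map (LinearMap.id : H →ₗ[k] H) φ
    ∘ₗ (TensorProduct.assoc k H B H).toLinearMap
    ∘ₗ TensorProduct.map φ (LinearMap.id : H →ₗ[k] H)
    ∘ₗ (TensorProduct.assoc k B H H).symm.toLinearMap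

/-- The threefold shuffle, with tensor factors bracketed to the right. -/
def smashShuffleRight (φ : B ⊗[k] H →ₗ[k] H ⊗[k] B) :
    (B ⊗[k] (B ⊗[k] B)) ⊗[k] (H ⊗[k] (H ⊗[k] H)) →ₗ[k]
      (B ⊗[k] H) ⊗[k] ((B ⊗[k] H) ⊗[k] (B ⊗[k] H)) :=
  (TensorProduct.assoc k B H _).symm.toLinearMap
  ∘ₗ TensorProduct.map LinearMap.id
      (TensorProduct.map LinearMap.id (smashShuffle φ)
        ∘ₗ (TensorProduct.assoc k H (B ⊗[k] B) (H ⊗[k] H)).toLinearMap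
        ∘ₗ TensorProduct.map (cotwistorLeft φ) LinearMap.id
        ∘ₗ (TensorProduct.assoc k (B ⊗[k] B) H (H ⊗[k] H)).symm.toLinearMap)
  ∘ₗ (TensorProduct.assoc k B (B ⊗[k] B) (H ⊗[k] (H ⊗[k] H))).toLinearMap

/-- The threefold shuffle, with tensor factors bracketed to the left. -/
def smashShuffleLeft (φ : B ⊗[k] H →ₗ[k] H ⊗[k] B) :
    ((B ⊗[k] B) ⊗[k] B) ⊗[k] ((H ⊗[k] H) ⊗[k] H) →ₗ[k]
      ((B ⊗[k] H) ⊗[k] (B ⊗[k] H)) ⊗[k] (B ⊗[k] H) :=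
  TensorProduct.map (smashShuffle φ) LinearMap.id
  ∘ₗ (TensorProduct.assoc k (B ⊗[k] B) (H ⊗[k] H) _).symm.toLinearMap
  ∘ₗ TensorProduct.map LinearMap.id
      ((TensorProduct.assoc k (H ⊗[k] H) B H).toLinearMap
        ∘ₗ TensorProduct.map (cotwistorRight φ) LinearMap.id
        ∘ₗ (TensorProduct.assoc k B (H ⊗[k] H) H).symm.toLinearMap)
  ∘ₗ (TensorProduct.assoc k (B ⊗[k] B) B ((H ⊗[k] H) ⊗[k] H)).toLinearMap

theorem assoc_smashShuffleLeft (φ : B ⊗[k] H →ₗ[k] H ⊗[k] B)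
    (p : (B ⊗[k] B) ⊗[k] B) (q : (H ⊗[k] H) ⊗[k] H) :
    TensorProduct.assoc k _ _ _ (smashShuffleLeft φ (p ⊗ₜ q)) =
      smashShuffleRight φ (TensorProduct.assoc k _ _ _ p ⊗ₜ TensorProduct.assoc k _ _ _ q) := by
  induction p with
  | zero => simp
  | add x y hx hy => simp only [map_add, add_tmul, hx, hy]
  | tmul p z =>
  induction q with
  | zero => simp
  | add x y hx hy => simp only [map_add, tmul_add, hx, hy]
  | tmul q w =>
  induction p with
  | zero => simp
  | add x y hx hy => simp only [map_add, add_tmul, hx, hy]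
  | tmul x y =>
  induction q with
  | zero => simp
  | add x y hx hy => simp only [map_add, add_tmul, tmul_add, hx, hy]
  | tmul u v =>
  simp only [smashShuffleLeft, smashShuffleRight, cotwistorLeft, cotwistorRight,
    LinearMap.comp_apply, LinearEquiv.coe_coe, assoc_tmul,
    assoc_symm_tmul, map_tmul, LinearMap.id_apply]
  induction φ (z ⊗ₜ[k] u) with
  | zero => simp
  | add x y hx hy => simp only [map_add, add_tmul, tmul_add, hx, hy]
  | tmul s t =>
  simp only [assoc_tmul, assoc_symm_tmul, map_tmul,
    LinearMap.id_apply]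
  trans (TensorProduct.assoc k B H _).symm (x ⊗ₜ TensorProduct.map LinearMap.id
    (TensorProduct.assoc k B H (B ⊗[k] H)).symm.toLinearMap
      (TensorProduct.assoc k H B _ (φ (y ⊗ₜ s) ⊗ₜ TensorProduct.assoc k H B H (φ (t ⊗ₜ v) ⊗ₜ w))))
  · induction φ (t ⊗ₜ[k] v) with
    | zero => simp
    | add x y hx hy => simp only [map_add, add_tmul, tmul_add, hx, hy]
    | tmul v' q =>
    simp only [assoc_tmul, assoc_symm_tmul, map_tmul,
      LinearMap.id_apply, smashShuffle_tmul]
    induction φ (y ⊗ₜ[k] s) with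
    | zero => simp
    | add x y hx hy => simp only [map_add, add_tmul, tmul_add, hx, hy]
    | tmul s' p => simp
  · induction φ (y ⊗ₜ[k] s) with
    | zero => simp
    | add x y hx hy => simp only [map_add, add_tmul, tmul_add, hx, hy]
    | tmul s' p => simp [smashShuffle_tmul]

theorem map_smashComul_right {αB : B ≃ₗ[k] B} {ΔB : B →ₗ[k] B ⊗[k] B}
    {αH : H ≃ₗ[k] H} {ΔH : H →ₗ[k] H ⊗[k] H} {φ : B ⊗[k] H →ₗ[k] H ⊗[k] B}
    (h1 : TensorProduct.map αH.toLinearMap ΔB ∘ₗ φ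
      = cotwistorLeft φ ∘ₗ TensorProduct.map ΔB αH.toLinearMap)
    (p : B ⊗[k] B) (q : H ⊗[k] H) :
    TensorProduct.map (TensorProduct.congr αB αH).toLinearMap (smashComul k φ ΔB ΔH)
        (smashShuffle φ (p ⊗ₜ q)) =
      smashShuffleRight φ (TensorProduct.map αB.toLinearMap ΔB p ⊗ₜ
        TensorProduct.map αH.toLinearMap ΔH q) := by
  induction p with
  | zero => simp
  | add x y hx hy => simp only [map_add, add_tmul, hx, hy]
  | tmul x y =>
  induction q with
  | zero => simp
  | add x y hx hy => simp only [map_add, tmul_add, hx, hy]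
  | tmul u v =>
  have h := LinearMap.congr_fun h1 (y ⊗ₜ u)
  simp only [LinearMap.comp_apply, map_tmul, LinearEquiv.coe_coe] at h
  simp only [smashShuffleRight, smashShuffle_tmul, LinearMap.comp_apply, LinearEquiv.coe_coe,
    map_tmul, assoc_tmul, assoc_symm_tmul,
    LinearMap.id_apply, ← h]
  induction φ (y ⊗ₜ[k] u) with
  | zero => simp
  | add x y hx hy => simp only [map_add, add_tmul, tmul_add, hx, hy]
  | tmul s t => simp [smashComul_tmul]

theorem map_smashComul_left {αB : B ≃ₗ[k] B} {ΔB : B →ₗ[k] B ⊗[k] B}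
    {αH : H ≃ₗ[k] H} {ΔH : H →ₗ[k] H ⊗[k] H} {φ : B ⊗[k] H →ₗ[k] H ⊗[k] B}
    (h2 : TensorProduct.map ΔH αB.toLinearMap ∘ₗ φ
      = cotwistorRight φ ∘ₗ TensorProduct.map αB.toLinearMap ΔH)
    (p : B ⊗[k] B) (q : H ⊗[k] H) :
    TensorProduct.map (smashComul k φ ΔB ΔH) (TensorProduct.congr αB αH).toLinearMap
        (smashShuffle φ (p ⊗ₜ q)) =
      smashShuffleLeft φ (TensorProduct.map ΔB αB.toLinearMap p ⊗ₜ
        TensorProduct.map ΔH αH.toLinearMap q) := by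
  induction p with
  | zero => simp
  | add x y hx hy => simp only [map_add, add_tmul, hx, hy]
  | tmul x y =>
  induction q with
  | zero => simp
  | add x y hx hy => simp only [map_add, tmul_add, hx, hy]
  | tmul u v =>
  have h := LinearMap.congr_fun h2 (y ⊗ₜ u)
  simp only [LinearMap.comp_apply, map_tmul, LinearEquiv.coe_coe] at h
  simp only [smashShuffleLeft, smashShuffle_tmul, LinearMap.comp_apply, LinearEquiv.coe_coe,
    map_tmul, assoc_tmul, assoc_symm_tmul,
    LinearMap.id_apply, ← h]
  induction φ (y ⊗ₜ[k] u) with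
  | zero => simp
  | add x y hx hy => simp only [map_add, add_tmul, tmul_add, hx, hy]
  | tmul s t => simp [smashComul_tmul]

/-- The smash coproduct along a Hom-cotwistor is a Hom-coalgebra. -/
theorem IsHomCotwistor.isHomCoalgebra_smashComul
    {αB : B ≃ₗ[k] B} {ΔB : B →ₗ[k] B ⊗[k] B} {εB : B →ₗ[k] k}
    {αH : H ≃ₗ[k] H} {ΔH : H →ₗ[k] H ⊗[k] H} {εH : H →ₗ[k] k}
    {φ : B ⊗[k] H →ₗ[k] H ⊗[k] B} (hφ : IsHomCotwistor k αB ΔB εB αH ΔH εH φ)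
    (hB : IsHomCoalgebra k αB ΔB εB) (hH : IsHomCoalgebra k αH ΔH εH) :
    IsHomCoalgebra k (TensorProduct.congr αB αH) (smashComul k φ ΔB ΔH)
      (smashCounit k εB εH) := by
  obtain ⟨hφ0, hφ1, hφ2, hφ3, hφ4⟩ := hφ
  obtain ⟨hB1, hB2, hB3, hB4, hB5⟩ := hB
  obtain ⟨hH1, hH2, hH3, hH4, hH5⟩ := hH
  refine ⟨fun c => ?_, fun c => ?_, fun c => ?_, fun c => ?_, fun c => ?_⟩
  all_goals
    induction c with
    | zero => simp
    | add x y hx hy => simp only [map_add, hx, hy]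
    | tmul b h => ?_
  · rw [congr_tmul, smashComul_tmul, smashComul_tmul, hB1, hH1]
    induction ΔB b with
    | zero => simp
    | add x y hx hy => simp only [map_add, add_tmul, hx, hy]
    | tmul x y =>
    induction ΔH h with
    | zero => simp
    | add x y hx hy => simp only [map_add, tmul_add, hx, hy]
    | tmul u v =>
    have h0 := LinearMap.congr_fun hφ0 (y ⊗ₜ u)
    simp only [LinearMap.comp_apply, map_tmul, LinearEquiv.coe_coe] at h0
    simp only [map_tmul, LinearEquiv.coe_coe, smashShuffle_tmul, h0]
    induction φ (y ⊗ₜ[k] u) with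
    | zero => simp
    | add x y hx hy =>
      simp only [map_add, add_tmul, tmul_add, hx, hy]
    | tmul s t => simp
  · simp only [congr_tmul, smashCounit_tmul, hB2, hH2]
  · rw [smashComul_tmul, map_smashComul_right hφ1, map_smashComul_left hφ2,
      assoc_smashShuffleLeft, hB3, hH3]
  · rw [smashComul_tmul, congr_tmul, ← hB4, ← hH4]
    induction ΔB b with
    | zero => simp
    | add x y hx hy => simp only [map_add, add_tmul, hx, hy]
    | tmul x y =>
    induction ΔH h with
    | zero => simp
    | add x y hx hy => simp only [map_add, tmul_add, hx, hy]
    | tmul u v =>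
    have h3 := LinearMap.congr_fun hφ3 (y ⊗ₜ u)
    simp only [LinearMap.comp_apply, map_tmul, LinearEquiv.coe_coe,
      LinearMap.id_apply, rid_tmul] at h3
    simp only [map_tmul, smashShuffle_tmul, lid_tmul,
      LinearMap.id_apply]
    rw [tmul_smul, ← smul_tmul', smul_comm, smul_tmul',
      ← h3]
    induction φ (y ⊗ₜ[k] u) with
    | zero => simp
    | add x y hx hy =>
      simp only [map_add, add_tmul, tmul_add, smul_add, hx, hy]
    | tmul s t => simp [smashCounit_tmul, mul_smul, smul_tmul']
  · rw [smashComul_tmul, congr_tmul, ← hB5, ← hH5]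
    induction ΔB b with
    | zero => simp
    | add x y hx hy => simp only [map_add, add_tmul, hx, hy]
    | tmul x y =>
    induction ΔH h with
    | zero => simp
    | add x y hx hy => simp only [map_add, tmul_add, hx, hy]
    | tmul u v =>
    have h4 := LinearMap.congr_fun hφ4 (y ⊗ₜ u)
    simp only [LinearMap.comp_apply, map_tmul, LinearEquiv.coe_coe,
      LinearMap.id_apply, lid_tmul] at h4
    simp only [map_tmul, smashShuffle_tmul, rid_tmul,
      LinearMap.id_apply]
    rw [smul_tmul, smul_comm, ← h4]
    induction φ (y ⊗ₜ[k] u) with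
    | zero => simp
    | add x y hx hy =>
      simp only [map_add, add_tmul, tmul_add, smul_add, hx, hy]
    | tmul s t => simp [smashCounit_tmul, smul_smul, mul_comm]

/-- The smash coproduct along a monoidal Hom-cotwistor is a Hom-bialgebra. -/
theorem IsMonoidalHomCotwistor.isHomBialgebra_smash
    {αB : B ≃ₗ[k] B} {μB : B →ₗ[k] B →ₗ[k] B} {eB : B}
    {ΔB : B →ₗ[k] B ⊗[k] B} {εB : B →ₗ[k] k}
    {αH : H ≃ₗ[k] H} {μH : H →ₗ[k] H →ₗ[k] H} {eH : H}
    {ΔH : H →ₗ[k] H ⊗[k] H} {εH : H →ₗ[k] k} {φ : B ⊗[k] H →ₗ[k] H ⊗[k] B}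
    (hφ : IsMonoidalHomCotwistor k αB μB eB ΔB εB αH μH eH ΔH εH φ)
    (hB : IsHomBialgebra k αB μB eB ΔB εB) (hH : IsHomBialgebra k αH μH eH ΔH εH) :
    IsHomBialgebra k (TensorProduct.congr αB αH) (smashMul k μB μH) (eB ⊗ₜ[k] eH)
      (smashComul k φ ΔB ΔH) (smashCounit k εB εH) := by
  obtain ⟨hφ, hφ5, hφ6⟩ := hφ
  obtain ⟨hBa, hBc, hB1, hB2, hB3, hB4⟩ := hB
  obtain ⟨hHa, hHc, hH1, hH2, hH3, hH4⟩ := hH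
  refine ⟨isHomAlgebra_smashMul hBa hHa, hφ.isHomCoalgebra_smashComul hBc hHc,
    fun a c => ?_, ?_, fun a c => ?_, ?_⟩
  · induction a with
    | zero => simp
    | add x y hx hy =>
      simp only [map_add, LinearMap.add_apply, add_tmul, hx, hy]
    | tmul b h =>
    induction c with
    | zero => simp
    | add x y hx hy => simp only [map_add, tmul_add, hx, hy]
    | tmul b' h' =>
    simp only [smashMul_tmul, smashComul_tmul, hB1, hH1]
    induction ΔB b with
    | zero => simp
    | add x y hx hy => simp only [map_add, add_tmul, hx, hy]
    | tmul x y =>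
    induction ΔB b' with
    | zero => simp
    | add x y hx hy => simp only [map_add, add_tmul, tmul_add, hx, hy]
    | tmul x' y' =>
    induction ΔH h with
    | zero => simp
    | add x y hx hy => simp only [map_add, add_tmul, tmul_add, hx, hy]
    | tmul u v =>
    induction ΔH h' with
    | zero => simp
    | add x y hx hy => simp only [map_add, tmul_add, hx, hy]
    | tmul u' v' =>
    have h5 := LinearMap.congr_fun hφ5 ((y ⊗ₜ u) ⊗ₜ (y' ⊗ₜ u'))
    simp only [LinearMap.comp_apply, map_tmul, LinearEquiv.coe_coe,
      tensorTensorTensorComm_tmul, TensorProduct.lift.tmul] at h5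
    simp only [map_tmul, tensorTensorTensorComm_tmul,
      TensorProduct.lift.tmul, smashShuffle_tmul, ← h5]
    induction φ (y ⊗ₜ[k] u) with
    | zero => simp
    | add x y hx hy => simp only [map_add, add_tmul, tmul_add, hx, hy]
    | tmul s t =>
    induction φ (y' ⊗ₜ[k] u') with
    | zero => simp
    | add x y hx hy => simp only [map_add, add_tmul, tmul_add, hx, hy]
    | tmul s' t' => simp [smashMul_tmul]
  · simp only [smashComul_tmul, hB2, hH2, smashShuffle_tmul, hφ6, assoc_tmul,
      assoc_symm_tmul]
  · induction a with
    | zero => simp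
    | add x y hx hy => simp only [map_add, LinearMap.add_apply, add_mul, hx, hy]
    | tmul b h =>
    induction c with
    | zero => simp
    | add x y hx hy => simp only [map_add, mul_add, hx, hy]
    | tmul b' h' =>
    simp only [smashMul_tmul, smashCounit_tmul, hB3, hH3]
    ring
  · simp only [smashCounit_tmul, hB4, hH4, mul_one]

end SmashCoproduct

section Symm

variable {k}
variable {A : Type*} [AddCommGroup A] [Module k A] {α : A ≃ₗ[k] A}

theorem IsHomAlgebra.symm_mul {μ : A →ₗ[k] A →ₗ[k] A} {e : A} (h : IsHomAlgebra k α μ e)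
    (a b : A) : α.symm (μ a b) = μ (α.symm a) (α.symm b) := by
  rw [LinearEquiv.symm_apply_eq, h.1]
  simp

theorem IsHomAlgebra.symm_one {μ : A →ₗ[k] A →ₗ[k] A} {e : A} (h : IsHomAlgebra k α μ e) :
    α.symm e = e := by
  rw [LinearEquiv.symm_apply_eq, h.2.2.1]

theorem IsHomCoalgebra.counit_symm {Δ : A →ₗ[k] A ⊗[k] A} {ε : A →ₗ[k] k}
    (h : IsHomCoalgebra k α Δ ε) (a : A) : ε (α.symm a) = ε a := by
  rw [← h.2.1, LinearEquiv.apply_symm_apply]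

theorem IsHomCoalgebra.comul_symm {Δ : A →ₗ[k] A ⊗[k] A} {ε : A →ₗ[k] k}
    (h : IsHomCoalgebra k α Δ ε) (a : A) :
    Δ (α.symm a) = TensorProduct.map α.symm.toLinearMap α.symm.toLinearMap (Δ a) := by
  conv_rhs => rw [← α.apply_symm_apply a, h.1]
  rw [← LinearMap.comp_apply, ← TensorProduct.map_comp]
  simp

end Symm

section Contraction

variable {k}
variable {A M : Type*} [AddCommGroup A] [Module k A] [AddCommGroup M] [Module k M]

/-- The map `M ⊗ A* → Hom(A, M)` sending `m ⊗ f` to `a ↦ f(a) m`. -/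
def tensorDualHom : M ⊗[k] Module.Dual k A →ₗ[k] A →ₗ[k] M :=
  dualTensorHom k A M ∘ₗ (TensorProduct.comm k M (Module.Dual k A)).toLinearMap

@[simp]
theorem tensorDualHom_tmul (m : M) (f : Module.Dual k A) (a : A) :
    tensorDualHom (m ⊗ₜ[k] f) a = f a • m := rfl

theorem tensorDualHom_injective [FiniteDimensional k A] :
    Function.Injective (tensorDualHom : M ⊗[k] Module.Dual k A →ₗ[k] A →ₗ[k] M) := by
  have h : Function.Injective (dualTensorHom k A M) := by
    have h' := (dualTensorHomEquivOfBasis (N := M) (Module.finBasis k A)).injective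
    intro x y hxy
    exact h' (by simpa using hxy)
  exact h.comp (TensorProduct.comm k M (Module.Dual k A)).injective

theorem dualDistrib_eq_tensorDualHom (p : Module.Dual k A ⊗[k] Module.Dual k A) (x y : A) :
    dualDistrib k A A p (x ⊗ₜ y) = tensorDualHom p y x := by
  induction p with
  | zero => simp
  | add p q hp hq => simp only [map_add, LinearMap.add_apply, hp, hq]
  | tmul f g => simp [mul_comm]

theorem dualDistrib_ext [FiniteDimensional k A] {p q : Module.Dual k A ⊗[k] Module.Dual k A}
    (h : ∀ x y, dualDistrib k A A p (x ⊗ₜ y) =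
      dualDistrib k A A q (x ⊗ₜ y)) : p = q := by
  apply tensorDualHom_injective
  ext y x
  simpa only [dualDistrib_eq_tensorDualHom] using h x y

/-- The map `A ⊗ M → M` contracting the first factor against a functional. -/
def contractWith (f : A →ₗ[k] k) : A ⊗[k] M →ₗ[k] M :=
  (TensorProduct.lid k M).toLinearMap ∘ₗ TensorProduct.map f LinearMap.id

@[simp]
theorem contractWith_tmul (f : A →ₗ[k] k) (a : A) (m : M) :
    contractWith f (a ⊗ₜ[k] m) = f a • m := rfl

end Contraction

section DualBialgebra

variable {k}
variable {A : Type*} [AddCommGroup A] [Module k A]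
  {αA : A ≃ₗ[k] A} {μA : A →ₗ[k] A →ₗ[k] A} {eA : A} {ΔA : A →ₗ[k] A ⊗[k] A} {εA : A →ₗ[k] k}

/-- The dual of a Hom-coalgebra is a Hom-algebra under convolution twisted by `α⁻²`. -/
theorem IsHomCoalgebra.isHomAlgebra_dual (hA : IsHomCoalgebra k αA ΔA εA)
    {star : Module.Dual k A →ₗ[k] Module.Dual k A →ₗ[k] Module.Dual k A}
    (hstar : ∀ (f f' : Module.Dual k A) (y : A),
        star f f' y = dualDistrib k A A
          ((f ∘ₗ (αA.symm.toLinearMap ∘ₗ αA.symm.toLinearMap)) ⊗ₜ[k]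
            (f' ∘ₗ (αA.symm.toLinearMap ∘ₗ αA.symm.toLinearMap))) (ΔA y)) :
    IsHomAlgebra k αA.symm.dualMap star (εA : Module.Dual k A) := by
  have hε := hA.counit_symm
  have hΔ := hA.comul_symm
  obtain ⟨-, -, h3, h4, h5⟩ := hA
  refine ⟨fun f g => ?_, fun f g h => ?_, ?_, fun f => ?_, fun f => ?_⟩
  · ext z
    simp only [LinearEquiv.dualMap_apply, hstar, hΔ]
    induction ΔA z with
    | zero => simp
    | add x y hx hy => simp only [map_add, hx, hy]
    | tmul x y => simp
  · ext z
    rw [hstar, hstar]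
    let β : A →ₗ[k] A := (αA.symm.toLinearMap ∘ₗ αA.symm.toLinearMap) ∘ₗ
      (αA.symm.toLinearMap ∘ₗ αA.symm.toLinearMap)
    let T : A ⊗[k] (A ⊗[k] A) →ₗ[k] k :=
      (TensorProduct.lid k k).toLinearMap ∘ₗ TensorProduct.map (f ∘ₗ β)
        ((TensorProduct.lid k k).toLinearMap ∘ₗ TensorProduct.map (g ∘ₗ β) (h ∘ₗ β))
    trans T (TensorProduct.map αA.toLinearMap ΔA (ΔA z))
    · induction ΔA z with
      | zero => simp
      | add x y hx hy => simp only [map_add, hx, hy]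
      | tmul x y =>
      simp only [dualDistrib_apply, LinearMap.comp_apply, hstar, LinearEquiv.coe_coe,
        hΔ, map_tmul, T, β]
      induction ΔA y with
      | zero => simp
      | add x y hx hy => simp only [map_add, tmul_add, mul_add, hx, hy]
      | tmul y w => simp [LinearEquiv.dualMap_apply]
    · rw [h3]
      induction ΔA z with
      | zero => simp
      | add x y hx hy => simp only [map_add, hx, hy]
      | tmul x y =>
      simp only [dualDistrib_apply, LinearMap.comp_apply, hstar, LinearEquiv.coe_coe,
        hΔ, map_tmul, T, β]
      induction ΔA x with
      | zero => simp
      | add x y hx hy => simp only [map_add, add_tmul, add_mul, hx, hy]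
      | tmul y w => simp [LinearEquiv.dualMap_apply, mul_assoc]
  · ext z
    simp [LinearEquiv.dualMap_apply, hε]
  · ext z
    rw [hstar, LinearEquiv.dualMap_apply]
    conv_rhs => rw [← αA.symm_apply_apply z, ← h4]
    induction ΔA z with
    | zero => simp
    | add x y hx hy => simp only [map_add, hx, hy]
    | tmul x y => simp [hε]
  · ext z
    rw [hstar, LinearEquiv.dualMap_apply]
    conv_rhs => rw [← αA.symm_apply_apply z, ← h5]
    induction ΔA z with
    | zero => simp
    | add x y hx hy => simp only [map_add, hx, hy]
    | tmul x y => simp [hε, mul_comm]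

/-- The dual of a finite-dimensional Hom-algebra, with the coopposite comultiplication, is a
Hom-coalgebra. -/
theorem IsHomAlgebra.isHomCoalgebra_dual [FiniteDimensional k A] (hA : IsHomAlgebra k αA μA eA)
    {Δbar : Module.Dual k A →ₗ[k] Module.Dual k A ⊗[k] Module.Dual k A}
    (hΔbar : ∀ (f : Module.Dual k A) (x y : A),
        dualDistrib k A A (Δbar f) (x ⊗ₜ[k] y)
          = f (αA.symm (αA.symm (μA y x)))) :
    IsHomCoalgebra k αA.symm.dualMap Δbar (Module.Dual.eval k A eA) := by
  have hμ := hA.symm_mul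
  have he := hA.symm_one
  obtain ⟨h1, h2, -, h4, h5⟩ := hA
  refine ⟨fun f => ?_, fun f => ?_, fun f => ?_, fun f => ?_, fun f => ?_⟩
  · refine dualDistrib_ext fun x y => ?_
    trans dualDistrib k A A (Δbar f) (αA.symm x ⊗ₜ αA.symm y)
    · simp only [hΔbar, LinearEquiv.dualMap_apply, hμ]
    · induction Δbar f with
      | zero => simp
      | add x y hx hy => simp only [map_add, LinearMap.add_apply, hx, hy]
      | tmul g h => simp [LinearEquiv.dualMap_apply]
  · simp [LinearEquiv.dualMap_apply, he]
  · apply (TensorProduct.assoc k _ _ _).symm.injective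
    rw [LinearEquiv.symm_apply_apply]
    apply tensorDualHom_injective (M := Module.Dual k A ⊗[k] Module.Dual k A)
    ext z : 1
    refine dualDistrib_ext fun x y => ?_
    trans dualDistrib k A A (Δbar f)
      (αA.symm x ⊗ₜ αA.symm (αA.symm (μA z y)))
    · induction Δbar f with
      | zero => simp
      | add x y hx hy => simp only [map_add, LinearMap.add_apply, hx, hy]
      | tmul g h =>
      simp only [map_tmul, dualDistrib_apply, ← hΔbar,
        LinearEquiv.coe_coe]
      induction Δbar h with
      | zero => simp
      | add x y hx hy =>
        simp only [map_add, tmul_add, LinearMap.add_apply, mul_add, hx, hy]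
      | tmul h h' =>
        simp [LinearEquiv.dualMap_apply]
        ring
    trans dualDistrib k A A (Δbar f)
      (αA.symm (αA.symm (μA y x)) ⊗ₜ αA.symm z)
    · simp only [hΔbar]
      congr 3
      have := h2 (αA.symm (αA.symm z)) (αA.symm (αA.symm y)) (αA.symm (αA.symm x))
      simpa [hμ] using this.symm
    · induction Δbar f with
      | zero => simp
      | add x y hx hy => simp only [map_add, LinearMap.add_apply, hx, hy]
      | tmul g h =>
      simp [← hΔbar, LinearEquiv.dualMap_apply, mul_comm]
  · ext y
    trans dualDistrib k A A (Δbar f) (eA ⊗ₜ y)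
    · induction Δbar f with
      | zero => simp
      | add x y hx hy => simp only [map_add, LinearMap.add_apply, hx, hy]
      | tmul g h => simp
    · simp [hΔbar, h5, LinearEquiv.dualMap_apply]
  · ext y
    trans dualDistrib k A A (Δbar f) (y ⊗ₜ eA)
    · induction Δbar f with
      | zero => simp
      | add x y hx hy => simp only [map_add, LinearMap.add_apply, hx, hy]
      | tmul g h => simp [mul_comm]
    · simp [hΔbar, h4, LinearEquiv.dualMap_apply]

/-- The coopposite dual of a finite-dimensional Hom-bialgebra is a Hom-bialgebra. -/
theorem IsHomBialgebra.isHomBialgebra_dual [FiniteDimensional k A]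
    (hA : IsHomBialgebra k αA μA eA ΔA εA)
    {Δbar : Module.Dual k A →ₗ[k] Module.Dual k A ⊗[k] Module.Dual k A}
    (hΔbar : ∀ (f : Module.Dual k A) (x y : A),
        dualDistrib k A A (Δbar f) (x ⊗ₜ[k] y)
          = f (αA.symm (αA.symm (μA y x))))
    {star : Module.Dual k A →ₗ[k] Module.Dual k A →ₗ[k] Module.Dual k A}
    (hstar : ∀ (f f' : Module.Dual k A) (y : A),
        star f f' y = dualDistrib k A A
          ((f ∘ₗ (αA.symm.toLinearMap ∘ₗ αA.symm.toLinearMap)) ⊗ₜ[k]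
            (f' ∘ₗ (αA.symm.toLinearMap ∘ₗ αA.symm.toLinearMap))) (ΔA y)) :
    IsHomBialgebra k αA.symm.dualMap star (εA : Module.Dual k A) Δbar
      (Module.Dual.eval k A eA) := by
  obtain ⟨ha, hc, h1, h2, h3, h4⟩ := hA
  have hμ := ha.symm_mul
  have he := ha.symm_one
  have hε := hc.counit_symm
  have hΔ := hc.comul_symm
  refine ⟨hc.isHomAlgebra_dual hstar, ha.isHomCoalgebra_dual hΔbar, fun f g => ?_, ?_,
    fun f g => ?_, ?_⟩
  · refine dualDistrib_ext fun x y => ?_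
    let β : A →ₗ[k] A := αA.symm.toLinearMap ∘ₗ αA.symm.toLinearMap
    trans (TensorProduct.lid k k)
      (TensorProduct.map (dualDistrib k A A (Δbar f) ∘ₗ TensorProduct.map β β)
        (dualDistrib k A A (Δbar g) ∘ₗ TensorProduct.map β β)
        (tensorTensorTensorComm k A A A A (ΔA x ⊗ₜ ΔA y)))
    · rw [hΔbar, hstar, hΔ, hΔ, h1]
      induction ΔA x with
      | zero => simp
      | add x y hx hy => simp only [map_add, tmul_add, add_tmul, hx, hy]
      | tmul x x' =>
      induction ΔA y with
      | zero => simp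
      | add x y hx hy => simp only [map_add, tmul_add, add_tmul, hx, hy]
      | tmul y y' => simp [hΔbar, hμ, β]
    · induction Δbar f with
      | zero => simp
      | add p q hp hq =>
        simp only [map_add, add_tmul, LinearMap.add_comp, map_add_left,
          LinearMap.add_apply, hp, hq]
      | tmul f f' =>
      induction Δbar g with
      | zero => simp
      | add p q hp hq =>
        simp only [map_add, tmul_add, LinearMap.add_comp, map_add_right,
          LinearMap.add_apply, hp, hq]
      | tmul g g' =>
      simp only [tensorTensorTensorComm_tmul, map_tmul,
        TensorProduct.lift.tmul, dualDistrib_apply, hstar]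
      induction ΔA x with
      | zero => simp
      | add x y hx hy => simp only [map_add, add_tmul, add_mul, hx, hy]
      | tmul x x' =>
      induction ΔA y with
      | zero => simp
      | add x y hx hy => simp only [map_add, tmul_add, mul_add, hx, hy]
      | tmul y y' =>
        simp [β]
        ring
  · refine dualDistrib_ext fun x y => ?_
    simp [hΔbar, hε, h3, mul_comm]
  · simp [hstar, h2, he]
  · simp [h4]

end DualBialgebra

section DualCotwistor

variable {k}
variable {A H : Type*} [AddCommGroup A] [Module k A] [AddCommGroup H] [Module k H]
  {αA : A ≃ₗ[k] A} {μA : A →ₗ[k] A →ₗ[k] A} {eA : A} {ΔA : A →ₗ[k] A ⊗[k] A} {εA : A →ₗ[k] k}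
  {αH : H ≃ₗ[k] H} {μH : H →ₗ[k] H →ₗ[k] H} {eH : H} {ΔH : H →ₗ[k] H ⊗[k] H} {εH : H →ₗ[k] k}
  {Φ : H ⊗[k] A →ₗ[k] A ⊗[k] H}
  {φ : Module.Dual k A ⊗[k] H →ₗ[k] H ⊗[k] Module.Dual k A}

theorem entwining_symm
    (h0 : TensorProduct.map αA.toLinearMap αH.toLinearMap ∘ₗ Φ
     = Φ ∘ₗ TensorProduct.map αH.toLinearMap αA.toLinearMap) (h : H) (a : A) :
    Φ (h ⊗ₜ αA.symm a) =
      TensorProduct.map αA.symm.toLinearMap αH.symm.toLinearMap (Φ (αH h ⊗ₜ a)) := by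
  have := LinearMap.congr_fun h0 (h ⊗ₜ αA.symm a)
  simp only [LinearMap.comp_apply, map_tmul, LinearEquiv.coe_coe,
    LinearEquiv.apply_symm_apply] at this
  rw [← this, ← LinearMap.comp_apply, ← TensorProduct.map_comp]
  simp

/-- The cotwistor on the dual of a Hom-entwining map is a Hom-cotwistor. -/
theorem IsHomEntwining.isHomCotwistor_dual [FiniteDimensional k A]
    (hΦ : IsHomEntwining k αA μA eA αH ΔH εH Φ)
    {Δbar : Module.Dual k A →ₗ[k] Module.Dual k A ⊗[k] Module.Dual k A}
    (hΔbar : ∀ (f : Module.Dual k A) (x y : A),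
        dualDistrib k A A (Δbar f) (x ⊗ₜ[k] y)
          = f (αA.symm (αA.symm (μA y x))))
    (hφ : ∀ f h x, tensorDualHom (φ (f ⊗ₜ[k] h)) x = contractWith f (Φ (h ⊗ₜ x))) :
    IsHomCotwistor k αA.symm.dualMap Δbar (Module.Dual.eval k A eA) αH ΔH εH φ := by
  obtain ⟨h0, h1, h2, h3, h4⟩ := hΦ
  have h0' := entwining_symm h0
  refine ⟨?_, ?_, ?_, ?_, ?_⟩
  all_goals refine TensorProduct.ext' fun f h => ?_
  · apply tensorDualHom_injective
    ext x
    trans αH (tensorDualHom (φ (f ⊗ₜ h)) (αA.symm x))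
    · simp only [LinearMap.comp_apply, map_tmul, LinearEquiv.coe_coe, hφ, h0']
      induction Φ (αH h ⊗ₜ[k] x) with
      | zero => simp
      | add x y hx hy => simp only [map_add, hx, hy]
      | tmul a s => simp [LinearEquiv.dualMap_apply]
    · rw [LinearMap.comp_apply]
      induction φ (f ⊗ₜ[k] h) with
      | zero => simp
      | add x y hx hy => simp only [map_add, LinearMap.add_apply, hx, hy]
      | tmul s g => simp [LinearEquiv.dualMap_apply]
  · apply (TensorProduct.assoc k _ _ _).symm.injective
    simp only [LinearMap.comp_apply, LinearEquiv.coe_coe, LinearEquiv.symm_apply_apply,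
      map_tmul]
    apply tensorDualHom_injective (M := H ⊗[k] Module.Dual k A)
    ext y : 1
    apply tensorDualHom_injective
    ext x
    trans αH (tensorDualHom (φ (f ⊗ₜ h)) (αA.symm (αA.symm (μA y x))))
    · induction φ (f ⊗ₜ[k] h) with
      | zero => simp
      | add x y hx hy => simp only [map_add, LinearMap.add_apply, hx, hy]
      | tmul s g =>
      simp only [map_tmul, LinearEquiv.coe_coe, tensorDualHom_tmul, ← hΔbar]
      induction Δbar g with
      | zero => simp
      | add x y hx hy =>
        simp only [map_add, LinearMap.add_apply, tmul_add, add_smul, hx, hy]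
      | tmul g g' => simp [smul_smul, mul_comm]
    · have e1 := LinearMap.congr_fun h1 ((αH h ⊗ₜ y) ⊗ₜ x)
      simp only [LinearMap.comp_apply, map_tmul, LinearEquiv.coe_coe,
        assoc_tmul, TensorProduct.lift.tmul, LinearMap.id_apply] at e1
      rw [hφ, h0', h0', ← e1]
      trans contractWith (dualDistrib k A A (Δbar f) ∘ₗ
          (TensorProduct.comm k A A).toLinearMap)
        ((TensorProduct.assoc k A A H).symm (TensorProduct.map LinearMap.id Φ
          (TensorProduct.assoc k A H A (Φ (αH h ⊗ₜ y) ⊗ₜ x))))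
      · induction (TensorProduct.assoc k A A H).symm (TensorProduct.map LinearMap.id Φ
          (TensorProduct.assoc k A H A (Φ (αH h ⊗ₜ y) ⊗ₜ x))) with
        | zero => simp
        | add x y hx hy => simp only [map_add, hx, hy]
        | tmul p s =>
        induction p with
        | zero => simp
        | add x y hx hy => simp only [map_add, add_tmul, hx, hy]
        | tmul a a' => simp [hΔbar]
      · induction Δbar f with
        | zero => simp [contractWith]
        | add p q hp hq =>
          simp only [map_add, add_tmul, LinearMap.add_apply, ← hp, ← hq]
          simp [contractWith, LinearMap.add_comp, map_add_left]
        | tmul g g' =>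
        trans contractWith g (Φ (contractWith g' (Φ (αH h ⊗ₜ y)) ⊗ₜ x))
        · induction Φ (αH h ⊗ₜ[k] y) with
          | zero => simp
          | add x y hx hy => simp only [map_add, add_tmul, hx, hy]
          | tmul a s =>
          simp only [map_tmul, assoc_tmul, LinearMap.id_apply,
            contractWith_tmul, ← smul_tmul', map_smul]
          induction Φ (s ⊗ₜ[k] x) with
          | zero => simp
          | add x y hx hy => simp only [map_add, tmul_add, smul_add, hx, hy]
          | tmul a' s' => simp [smul_smul, mul_comm]
        · rw [← hφ, ← hφ]
          simp only [map_tmul, assoc_tmul, LinearMap.id_apply]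
          induction φ (g' ⊗ₜ[k] αH h) with
          | zero => simp
          | add x y hx hy =>
            simp only [map_add, tmul_add, LinearMap.add_apply, hx, hy]
          | tmul s t => simp
  · apply tensorDualHom_injective
    ext x : 1
    have e2 := LinearMap.congr_fun h2 (h ⊗ₜ αA.symm x)
    simp only [LinearMap.comp_apply, map_tmul, LinearEquiv.coe_coe,
      LinearEquiv.apply_symm_apply] at e2
    simp only [LinearMap.comp_apply, map_tmul, LinearEquiv.coe_coe]
    trans ΔH (tensorDualHom (φ (f ⊗ₜ h)) (αA.symm x))
    · induction φ (f ⊗ₜ[k] h) with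
      | zero => simp
      | add x y hx hy => simp only [map_add, LinearMap.add_apply, hx, hy]
      | tmul s g => simp [LinearEquiv.dualMap_apply]
    rw [hφ]
    trans contractWith (αA.symm.dualMap f)
      (TensorProduct.map αA.toLinearMap ΔH (Φ (h ⊗ₜ αA.symm x)))
    · induction Φ (h ⊗ₜ[k] αA.symm x) with
      | zero => simp
      | add x y hx hy => simp only [map_add, hx, hy]
      | tmul a s => simp [LinearEquiv.dualMap_apply]
    rw [e2]
    induction ΔH h with
    | zero => simp
    | add x y hx hy =>
      simp only [map_add, add_tmul, tmul_add, LinearMap.add_apply,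
        hx, hy]
    | tmul u v =>
    simp only [map_tmul, assoc_tmul, assoc_symm_tmul,
      LinearMap.id_apply]
    trans TensorProduct.map (tensorDualHom (φ (αA.symm.dualMap f ⊗ₜ u))) LinearMap.id
      (Φ (v ⊗ₜ x))
    · induction Φ (v ⊗ₜ[k] x) with
      | zero => simp
      | add x y hx hy => simp only [map_add, tmul_add, hx, hy]
      | tmul a r =>
      simp only [map_tmul, hφ, LinearMap.id_apply, assoc_symm_tmul]
      induction Φ (u ⊗ₜ[k] a) with
      | zero => simp
      | add x y hx hy => simp only [map_add, add_tmul, hx, hy]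
      | tmul a s => simp [smul_tmul']
    · induction φ (αA.symm.dualMap f ⊗ₜ[k] u) with
      | zero => simp
      | add x y hx hy =>
        simp only [map_add, add_tmul, map_add_left,
          LinearMap.add_apply, hx, hy]
      | tmul s g =>
      trans s ⊗ₜ tensorDualHom (φ (g ⊗ₜ v)) x
      · rw [hφ]
        induction Φ (v ⊗ₜ[k] x) with
        | zero => simp
        | add x y hx hy => simp only [map_add, tmul_add, hx, hy]
        | tmul a r => simp [smul_tmul']
      · simp only [map_tmul, assoc_tmul, LinearMap.id_apply]
        induction φ (g ⊗ₜ[k] v) with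
        | zero => simp
        | add x y hx hy =>
          simp only [map_add, tmul_add, LinearMap.add_apply, hx, hy]
        | tmul a r => simp
  · ext x
    have e3 := LinearMap.congr_fun h3 (h ⊗ₜ x)
    trans εH (tensorDualHom (φ (f ⊗ₜ h)) x)
    · rw [LinearMap.comp_apply, LinearMap.comp_apply]
      induction φ (f ⊗ₜ[k] h) with
      | zero => simp
      | add x y hx hy => simp only [map_add, LinearMap.add_apply, hx, hy]
      | tmul s g => simp [mul_comm]
    rw [hφ]
    trans f (εH h • x)
    · simp only [LinearMap.comp_apply, map_tmul, LinearEquiv.coe_coe,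
        lid_tmul, LinearMap.id_apply] at e3
      rw [← e3]
      induction Φ (h ⊗ₜ[k] x) with
      | zero => simp
      | add x y hx hy => simp only [map_add, hx, hy]
      | tmul s g => simp [mul_comm]
    · simp
  · trans tensorDualHom (φ (f ⊗ₜ h)) eA
    · rw [LinearMap.comp_apply, LinearMap.comp_apply]
      induction φ (f ⊗ₜ[k] h) with
      | zero => simp
      | add x y hx hy => simp only [map_add, LinearMap.add_apply, hx, hy]
      | tmul s g => simp
    · simp [hφ, h4]

/-- The cotwistor on the dual of a Hom-monoidal entwining datum is a monoidal Hom-cotwistor. -/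
theorem IsHomMonoidalEntwining.isMonoidalHomCotwistor_dual [FiniteDimensional k A]
    (hH : IsHomAlgebra k αH μH eH)
    (hΦ : IsHomMonoidalEntwining k αA μA eA ΔA εA αH μH eH ΔH εH Φ)
    {Δbar : Module.Dual k A →ₗ[k] Module.Dual k A ⊗[k] Module.Dual k A}
    (hΔbar : ∀ (f : Module.Dual k A) (x y : A),
        dualDistrib k A A (Δbar f) (x ⊗ₜ[k] y)
          = f (αA.symm (αA.symm (μA y x))))
    {star : Module.Dual k A →ₗ[k] Module.Dual k A →ₗ[k] Module.Dual k A}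
    (hstar : ∀ (f f' : Module.Dual k A) (y : A),
        star f f' y = dualDistrib k A A
          ((f ∘ₗ (αA.symm.toLinearMap ∘ₗ αA.symm.toLinearMap)) ⊗ₜ[k]
            (f' ∘ₗ (αA.symm.toLinearMap ∘ₗ αA.symm.toLinearMap))) (ΔA y))
    (hφ : ∀ f h x, tensorDualHom (φ (f ⊗ₜ[k] h)) x = contractWith f (Φ (h ⊗ₜ x))) :
    IsMonoidalHomCotwistor k αA.symm.dualMap star (εA : Module.Dual k A) Δbar
      (Module.Dual.eval k A eA) αH μH eH ΔH εH φ := by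
  obtain ⟨hE, h5, h6⟩ := hΦ
  have h0' := entwining_symm hE.1
  refine ⟨hE.isHomCotwistor_dual hΔbar hφ, ?_, ?_⟩
  · refine TensorProduct.ext_fourfold' fun f h f' h' => ?_
    apply tensorDualHom_injective
    ext z
    have e5 := LinearMap.congr_fun h5 ((h ⊗ₜ h') ⊗ₜ z)
    simp only [LinearMap.comp_apply, map_tmul, LinearEquiv.coe_coe,
      TensorProduct.lift.tmul, LinearMap.id_apply] at e5
    simp only [LinearMap.comp_apply, map_tmul, LinearEquiv.coe_coe,
      TensorProduct.lift.tmul, tensorTensorTensorComm_tmul]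
    let β : A →ₗ[k] A := αA.symm.toLinearMap ∘ₗ αA.symm.toLinearMap
    trans TensorProduct.lift μH (TensorProduct.map (tensorDualHom (φ (f ⊗ₜ h)) ∘ₗ β)
      (tensorDualHom (φ (f' ⊗ₜ h')) ∘ₗ β) (ΔA z))
    · induction φ (f ⊗ₜ[k] h) with
      | zero => simp
      | add x y hx hy =>
        simp only [map_add, LinearMap.add_apply, add_tmul, LinearMap.add_comp,
          map_add_left, hx, hy]
      | tmul s g =>
      induction φ (f' ⊗ₜ[k] h') with
      | zero => simp
      | add x y hx hy =>
        simp only [map_add, LinearMap.add_apply, tmul_add, LinearMap.add_comp,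
          map_add_right, hx, hy]
      | tmul s' g' =>
      simp only [map_tmul, TensorProduct.lift.tmul,
        tensorTensorTensorComm_tmul, tensorDualHom_tmul, hstar]
      induction ΔA z with
      | zero => simp
      | add x y hx hy => simp only [map_add, add_smul, hx, hy]
      | tmul x y => simp [β, smul_smul, mul_comm]
    · rw [hφ]
      trans αH.symm (αH.symm (contractWith
        (dualDistrib k A A ((f ∘ₗ β) ⊗ₜ[k] (f' ∘ₗ β)))
        (TensorProduct.map ΔA (αH.toLinearMap ∘ₗ αH.toLinearMap) (Φ (μH h h' ⊗ₜ z)))))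
      · rw [← e5]
        induction ΔA z with
        | zero => simp
        | add x y hx hy => simp only [map_add, tmul_add, hx, hy]
        | tmul x y =>
        simp only [map_tmul, TensorProduct.lift.tmul, LinearMap.comp_apply,
          tensorTensorTensorComm_tmul, hφ, h0', β, LinearEquiv.coe_coe]
        induction Φ (αH (αH h) ⊗ₜ[k] x) with
        | zero => simp
        | add x y hx hy =>
          simp only [map_add, LinearMap.add_apply, add_tmul, hx, hy]
        | tmul a s =>
        induction Φ (αH (αH h') ⊗ₜ[k] y) with
        | zero => simp
        | add x y hx hy => simp only [map_add, tmul_add, hx, hy]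
        | tmul a' s' => simp [hH.symm_mul, smul_smul, mul_comm]
      · induction Φ (μH h h' ⊗ₜ[k] z) with
        | zero => simp
        | add x y hx hy => simp only [map_add, hx, hy]
        | tmul a s => simp [hstar, β]
  · apply tensorDualHom_injective
    ext x
    rw [hφ]
    exact h6 x

end DualCotwistor

/-- for a Hom-monoidal entwining datum `(H, A, Φ)` with `A`
finite-dimensional, the smash coproduct `A*^cop ⊗ H` is a Hom-bialgebra. -/
theorem homMonoidalEntwining_smashCoproduct_isHomBialgebra
    {A H : Type*} [AddCommGroup A] [Module k A] [AddCommGroup H] [Module k H]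
    [FiniteDimensional k A]
    {ι : Type*} [Fintype ι] [DecidableEq ι] (b : Module.Basis ι k A)
    (αA : A ≃ₗ[k] A) (μA : A →ₗ[k] A →ₗ[k] A) (eA : A)
    (ΔA : A →ₗ[k] A ⊗[k] A) (εA : A →ₗ[k] k)
    (αH : H ≃ₗ[k] H) (μH : H →ₗ[k] H →ₗ[k] H) (eH : H)
    (ΔH : H →ₗ[k] H ⊗[k] H) (εH : H →ₗ[k] k)
    (hA : IsHomBialgebra k αA μA eA ΔA εA)
    (hH : IsHomBialgebra k αH μH eH ΔH εH)
    (Φ : H ⊗[k] A →ₗ[k] A ⊗[k] H)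
    (hΦ : IsHomMonoidalEntwining k αA μA eA ΔA εA αH μH eH ΔH εH Φ)
    (Δbar : Module.Dual k A →ₗ[k] Module.Dual k A ⊗[k] Module.Dual k A)
    (hΔbar : ∀ (f : Module.Dual k A) (x y : A),
        TensorProduct.dualDistrib k A A (Δbar f) (x ⊗ₜ[k] y)
          = f (αA.symm (αA.symm (μA y x))))
    (star : Module.Dual k A →ₗ[k] Module.Dual k A →ₗ[k] Module.Dual k A)
    (hstar : ∀ (f f' : Module.Dual k A) (y : A),
        star f f' y = TensorProduct.dualDistrib k A A
          ((f ∘ₗ (αA.symm.toLinearMap ∘ₗ αA.symm.toLinearMap)) ⊗ₜ[k]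
            (f' ∘ₗ (αA.symm.toLinearMap ∘ₗ αA.symm.toLinearMap))) (ΔA y))
    (φ : Module.Dual k A ⊗[k] H →ₗ[k] H ⊗[k] Module.Dual k A)
    (hφ : ∀ (f : Module.Dual k A) (h : H),
        φ (f ⊗ₜ[k] h) = ∑ i, (TensorProduct.lid k H
            (TensorProduct.map (f : A →ₗ[k] k) (LinearMap.id : H →ₗ[k] H)
              (Φ (h ⊗ₜ[k] b i)))) ⊗ₜ[k] b.dualBasis i) :
    IsHomBialgebra k (TensorProduct.congr αA.symm.dualMap αH)
      (smashMul k star μH) ((εA : Module.Dual k A) ⊗ₜ[k] eH)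
      (smashComul k φ Δbar ΔH)
      (smashCounit k (Module.Dual.eval k A eA) εH) := by
  refine (hΦ.isMonoidalHomCotwistor_dual hH.1 hΔbar hstar fun f h x => ?_).isHomBialgebra_smash
    (hA.isHomBialgebra_dual hΔbar hstar) hH
  refine LinearMap.congr_fun (f := tensorDualHom (φ (f ⊗ₜ h)))
    (g := contractWith f ∘ₗ Φ ∘ₗ TensorProduct.mk k H A h) (b.ext fun j => ?_) x
  rw [hφ, map_sum, LinearMap.sum_apply]
  simp only [tensorDualHom_tmul, Module.Basis.dualBasis_apply_self, ite_smul, one_smul, zero_smul,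
    Finset.sum_ite_eq, Finset.mem_univ, if_true]
  rfl
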